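/- For every ω ∈ (-1,0), the operator −d²/dz² + 1 − 3(1−ω²)/(ω + cosh 2z)² has a negative direction: there exists a smooth compactly supported real-valued function ψ on ℝ with ∫_ℝ [ ψ'(z)² + ( 1 − 3(1−ω²)/(ω + cosh 2z)² ) ψ(z)² ] dz < 0. -/

import Mathlib

open MeasureTheory

lemma add_cosh_pos {ω : ℝ} (hω : -1 < ω) (z : ℝ) : 0 < ω + Real.cosh (2 * z) := by
  linarith [Real.one_le_cosh (2 * z)]

lemma hasDerivAt_add_cosh (ω z : ℝ) :
    HasDerivAt (fun z : ℝ => ω + Real.cosh (2 * z)) (2 * Real.sinh (2 * z)) z := by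
  have h := (((hasDerivAt_id z).const_mul 2).cosh).const_add ω
  simpa [mul_comm] using h

/-- The ground state substitution: the energy density of `χ / √(ω + cosh 2z)` is
`(χ')² / (ω + cosh 2z) + 4 ω χ² / (ω + cosh 2z)²` up to an exact derivative. -/
lemma energy_density_eq {ω : ℝ} (hω : -1 < ω) {χ : ℝ → ℝ} (hχ : Differentiable ℝ χ) (z : ℝ) :
    (deriv (fun z => χ z / √(ω + Real.cosh (2 * z))) z) ^ 2
        + (1 - 3 * (1 - ω ^ 2) / (ω + Real.cosh (2 * z)) ^ 2)
          * (χ z / √(ω + Real.cosh (2 * z))) ^ 2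
      = (deriv χ z) ^ 2 / (ω + Real.cosh (2 * z))
        + 4 * ω * (χ z ^ 2 / (ω + Real.cosh (2 * z)) ^ 2)
        - deriv (fun z => χ z ^ 2 * Real.sinh (2 * z) / (ω + Real.cosh (2 * z)) ^ 2) z := by
  have hu := add_cosh_pos hω z
  have hdu := hasDerivAt_add_cosh ω z
  have hdχ := (hχ z).hasDerivAt
  have hds : HasDerivAt (fun z : ℝ => Real.sinh (2 * z)) (2 * Real.cosh (2 * z)) z := by
    simpa [mul_comm] using ((hasDerivAt_id z).const_mul 2).sinh
  have hψ := (hdχ.fun_div (hdu.sqrt hu.ne') (Real.sqrt_pos.2 hu).ne').deriv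
  have hG := (((hdχ.fun_pow 2).fun_mul hds).fun_div (hdu.fun_pow 2) (pow_pos hu 2).ne').deriv
  rw [hψ, hG]
  have hcs := Real.cosh_sq (2 * z)
  set c := Real.cosh (2 * z)
  set s := Real.sinh (2 * z)
  have hs : s ^ 2 = c ^ 2 - 1 := by linarith
  obtain ⟨r, hr, hru⟩ : ∃ r, 0 < r ∧ r ^ 2 = ω + c := ⟨_, Real.sqrt_pos.2 hu, Real.sq_sqrt hu.le⟩
  rw [← hru, Real.sqrt_sq hr.le]
  have hω' : ω = r ^ 2 - c := by linarith
  subst hω'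
  field_simp
  norm_num
  ring_nf
  rw [hs]
  ring

theorem stmt17 (ω : ℝ) (hω₁ : -1 < ω) (hω₂ : ω < 0) :
    ∃ ψ : ℝ → ℝ, ContDiff ℝ (⊤ : ℕ∞) ψ ∧ HasCompactSupport ψ ∧
      (∫ z : ℝ, ((deriv ψ z) ^ 2
        + (1 - 3 * (1 - ω ^ 2) / (ω + Real.cosh (2 * z)) ^ 2) * (ψ z) ^ 2)) < 0 := by
  have hu := add_cosh_pos hω₁
  have hucd : ContDiff ℝ (⊤ : ℕ∞) fun z : ℝ => ω + Real.cosh (2 * z) :=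
    contDiff_const.add (Real.contDiff_cosh.comp (contDiff_const.mul contDiff_id))
  have hscd : ContDiff ℝ (⊤ : ℕ∞) fun z : ℝ => Real.sinh (2 * z) :=
    Real.contDiff_sinh.comp (contDiff_const.mul contDiff_id)
  let η : ContDiffBump (0 : ℝ) := ⟨1, 2, one_pos, one_lt_two⟩
  have hηcd : ContDiff ℝ (⊤ : ℕ∞) η := η.contDiff
  set K := ∫ z in (-1 : ℝ)..1, 1 / (ω + Real.cosh (2 * z)) ^ 2 with hKdef
  set E := ∫ z : ℝ, (deriv η z) ^ 2 with hEdef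
  have hcont : Continuous fun z : ℝ => 1 / (ω + Real.cosh (2 * z)) ^ 2 :=
    continuous_const.div (hucd.continuous.pow 2) fun z => (pow_pos (hu z) 2).ne'
  have hK : 0 < K :=
    intervalIntegral.intervalIntegral_pos_of_pos (hcont.intervalIntegrable _ _)
      (fun z => by have := hu z; positivity) (by norm_num)
  obtain ⟨R, hR1, hR⟩ : ∃ R : ℝ, 1 ≤ R ∧ E / (1 + ω) / R < -(4 * ω * K) := by
    have hpos : 0 < -(4 * ω * K) := by nlinarith [mul_pos (neg_pos.2 hω₂) hK]
    have h1 := Filter.Tendsto.const_div_atTop (Filter.tendsto_id (α := ℝ)) (E / (1 + ω))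
    obtain ⟨R, h2, h3⟩ :=
      ((h1.eventually (gt_mem_nhds hpos)).and (Filter.eventually_ge_atTop 1)).exists
    exact ⟨R, h3, h2⟩
  have hR0 : 0 < R := by linarith
  set χ : ℝ → ℝ := fun z => η (R⁻¹ * z)
  have hχcd : ContDiff ℝ (⊤ : ℕ∞) χ := hηcd.comp (contDiff_const.mul contDiff_id)
  have hχcs : HasCompactSupport χ :=
    η.hasCompactSupport.comp_homeomorph (Homeomorph.mulLeft₀ R⁻¹ (inv_ne_zero hR0.ne'))
  have hχd : Differentiable ℝ χ := hχcd.differentiable (by simp)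
  have hχ' : ∀ z, deriv χ z = R⁻¹ * deriv η (R⁻¹ * z) := fun z => by
    simpa using deriv_comp_mul_left R⁻¹ η z
  have hχ1 : ∀ z ∈ Set.Ioc (-1 : ℝ) 1, χ z = 1 := fun z hz => by
    apply η.one_of_mem_closedBall
    rw [mem_closedBall_zero_iff, norm_mul, Real.norm_eq_abs, Real.norm_eq_abs,
      abs_of_pos (inv_pos.2 hR0)]
    exact mul_le_one₀ (inv_le_one_of_one_le₀ hR1) (abs_nonneg _) (abs_le.2 ⟨hz.1.le, hz.2⟩)
  have hχdc : Continuous (deriv χ) := hχcd.continuous_deriv (by simp)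
  set G : ℝ → ℝ := fun z => χ z ^ 2 * Real.sinh (2 * z) / (ω + Real.cosh (2 * z)) ^ 2 with hG
  have hGcd : ContDiff ℝ (⊤ : ℕ∞) G :=
    ((hχcd.pow 2).mul hscd).div (hucd.pow 2) fun z => (pow_pos (hu z) 2).ne'
  have hGcs : HasCompactSupport G := hχcs.mono fun z hz h => hz (by simp [hG, h])
  have hGi : Integrable G := hGcd.continuous.integrable_of_hasCompactSupport hGcs
  have hG'i : Integrable (deriv G) :=
    (hGcd.continuous_deriv (by simp)).integrable_of_hasCompactSupport hGcs.deriv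
  have hG0 : ∫ z, deriv G z = 0 :=
    integral_eq_zero_of_hasDerivAt_of_integrable
      (fun z => ((hGcd.differentiable (by simp)) z).hasDerivAt) hG'i hGi
  have hAi : Integrable fun z => (deriv χ z) ^ 2 / (ω + Real.cosh (2 * z)) :=
    ((hχdc.pow 2).div hucd.continuous fun z => (hu z).ne').integrable_of_hasCompactSupport
      (hχcs.deriv.mono fun z hz h => hz (by simp [h]))
  have hBi : Integrable fun z => χ z ^ 2 / (ω + Real.cosh (2 * z)) ^ 2 :=
    ((hχcd.continuous.pow 2).div (hucd.continuous.pow 2)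
      fun z => (pow_pos (hu z) 2).ne').integrable_of_hasCompactSupport
      (hχcs.mono fun z hz h => hz (by simp [h]))
  have hA : ∫ z, (deriv χ z) ^ 2 / (ω + Real.cosh (2 * z)) ≤ E / (1 + ω) / R := by
    have hi : Integrable fun z => (deriv χ z) ^ 2 / (1 + ω) :=
      ((hχdc.pow 2).div_const _).integrable_of_hasCompactSupport
        (hχcs.deriv.mono fun z hz h => hz (by simp [h]))
    calc _ ≤ ∫ z, (deriv χ z) ^ 2 / (1 + ω) := by
          refine integral_mono hAi hi fun z => ?_
          have h1 : 0 < 1 + ω := by linarith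
          have h2 : 1 + ω ≤ ω + Real.cosh (2 * z) := by linarith [Real.one_le_cosh (2 * z)]
          dsimp only
          gcongr
      _ = E / (1 + ω) / R := by
          simp_rw [hχ', mul_pow]
          rw [integral_div, integral_const_mul,
            Measure.integral_comp_mul_left (fun z => (deriv η z) ^ 2) R⁻¹, ← hEdef, inv_inv,
            abs_of_pos hR0, smul_eq_mul]
          field_simp
  have hB : K ≤ ∫ z, χ z ^ 2 / (ω + Real.cosh (2 * z)) ^ 2 := by
    rw [hKdef, intervalIntegral.integral_of_le (by norm_num)]
    calc _ = ∫ z in Set.Ioc (-1 : ℝ) 1, χ z ^ 2 / (ω + Real.cosh (2 * z)) ^ 2 :=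
          setIntegral_congr_fun measurableSet_Ioc fun z hz => by simp [hχ1 z hz]
      _ ≤ _ := setIntegral_le_integral hBi (.of_forall fun z => by
          have := hu z
          simp only [Pi.zero_apply]
          positivity)
  refine ⟨fun z => χ z / √(ω + Real.cosh (2 * z)), ?_, ?_, ?_⟩
  · exact hχcd.div (hucd.sqrt fun z => (hu z).ne') fun z => (Real.sqrt_pos.2 (hu z)).ne'
  · exact hχcs.mono fun z hz h => hz (by simp [h])
  · simp_rw [energy_density_eq hω₁ hχd]
    have hABi : Integrable fun z => (deriv χ z) ^ 2 / (ω + Real.cosh (2 * z))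
        + 4 * ω * (χ z ^ 2 / (ω + Real.cosh (2 * z)) ^ 2) := hAi.add (hBi.const_mul _)
    rw [integral_sub hABi hG'i, integral_add hAi (hBi.const_mul _),
      integral_const_mul, hG0]
    nlinarith [mul_le_mul_of_nonneg_left hB (neg_pos.2 hω₂).le]
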